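/- For n > 1, the index of the distillation subgroup D_n in Sp(2n, F_2) equals (1/3)(2^n − 1) · ∏_{j=1}^n (2^j + 1). -/

import Mathlib

open Matrix

def Omega (n : ℕ) : Matrix (Fin n ⊕ Fin n) (Fin n ⊕ Fin n) (ZMod 2) :=
  Matrix.fromBlocks 0 1 1 0

def base (n : ℕ) (hn : 0 < n) : Set (Fin n ⊕ Fin n → ZMod 2) :=
  {v | (∀ i : Fin n, v (Sum.inl i) = 0) ∧ v (Sum.inr ⟨0, hn⟩) = 0}

def om (n : ℕ) (v w : Fin n ⊕ Fin n → ZMod 2) : ZMod 2 := v ⬝ᵥ (Omega n *ᵥ w)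

lemma om_eq (n : ℕ) (v w : Fin n ⊕ Fin n → ZMod 2) :
    om n v w = ∑ i, (v (Sum.inl i) * w (Sum.inr i) + v (Sum.inr i) * w (Sum.inl i)) := by
  simp [om, Omega, dotProduct, Matrix.fromBlocks_mulVec, Finset.sum_add_distrib]

lemma om_comm (n : ℕ) (v w : Fin n ⊕ Fin n → ZMod 2) : om n v w = om n w v := by
  rw [om_eq, om_eq]
  exact Finset.sum_congr rfl fun i _ => by ring

lemma om_self (n : ℕ) (v : Fin n ⊕ Fin n → ZMod 2) : om n v v = 0 := by
  rw [om_eq]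
  refine Finset.sum_eq_zero fun i _ => ?_
  rw [mul_comm]
  exact CharTwo.add_self_eq_zero _

lemma Omega_sq (n : ℕ) : Omega n * Omega n = 1 := by
  simp [Omega, Matrix.fromBlocks_multiply]

lemma Omega_det (n : ℕ) : IsUnit (Omega n).det :=
  (Matrix.isUnit_iff_isUnit_det _).1 (IsUnit.of_mul_eq_one _ (Omega_sq n))

/-- The pairing with a tuple. -/
def pair (n k : ℕ) (t : Fin k → Fin n ⊕ Fin n → ZMod 2) :
    (Fin n ⊕ Fin n → ZMod 2) →ₗ[ZMod 2] (Fin k → ZMod 2) :=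
  Matrix.mulVecLin (Matrix.of t * Omega n)

lemma pair_apply (n k : ℕ) (t : Fin k → Fin n ⊕ Fin n → ZMod 2) (w) (i) :
    pair n k t w i = om n (t i) w := by
  simp only [pair, Matrix.mulVecLin_apply, ← Matrix.mulVec_mulVec, om]
  rfl

lemma pair_range (n k : ℕ) (t : Fin k → Fin n ⊕ Fin n → ZMod 2)
    (ht : LinearIndependent (ZMod 2) t) : LinearMap.range (pair n k t) = ⊤ := by
  apply Submodule.eq_top_of_finrank_eq
  have h : (Matrix.of t * Omega n).rank = k := by
    rw [Matrix.rank_mul_eq_left_of_isUnit_det _ _ (Omega_det n)]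
    have := LinearIndependent.rank_matrix (M := Matrix.of t) ht
    simpa using this
  rw [Module.finrank_fin_fun]
  exact h

lemma pair_ker (n k : ℕ) (t : Fin k → Fin n ⊕ Fin n → ZMod 2)
    (ht : LinearIndependent (ZMod 2) t) :
    Nat.card (LinearMap.ker (pair n k t)) = 2 ^ (2 * n - k) := by
  have h1 := LinearMap.finrank_range_add_finrank_ker (pair n k t)
  rw [pair_range n k t ht] at h1
  simp at h1
  rw [Module.natCard_eq_pow_finrank (K := ZMod 2)]
  simp
  omega

def IT (n k : ℕ) (t : Fin k → Fin n ⊕ Fin n → ZMod 2) : Prop :=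
  LinearIndependent (ZMod 2) t ∧ ∀ i j, om n (t i) (t j) = 0

def ExtS (n k : ℕ) (t : Fin k → Fin n ⊕ Fin n → ZMod 2) : Set (Fin n ⊕ Fin n → ZMod 2) :=
  (LinearMap.ker (pair n k t) : Set _) \ (Submodule.span (ZMod 2) (Set.range t) : Set _)

lemma card_ExtS (n k : ℕ) (t : Fin k → Fin n ⊕ Fin n → ZMod 2) (ht : IT n k t) :
    Nat.card (ExtS n k t) = 2 ^ (2 * n - k) - 2 ^ k := by
  have hs : (Submodule.span (ZMod 2) (Set.range t) : Set _) ⊆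
      (LinearMap.ker (pair n k t) : Set (Fin n ⊕ Fin n → ZMod 2)) := by
    rw [SetLike.coe_subset_coe, Submodule.span_le]
    rintro _ ⟨i, rfl⟩
    simp only [SetLike.mem_coe, LinearMap.mem_ker]
    ext j
    rw [pair_apply, ht.2]; rfl
  change Set.ncard _ = _
  rw [ExtS, Set.ncard_sdiff hs]
  change Nat.card (LinearMap.ker (pair n k t)) -
    Nat.card (Submodule.span (ZMod 2) (Set.range t)) = _
  rw [pair_ker n k t ht.1, Module.natCard_eq_pow_finrank (K := ZMod 2), finrank_span_eq_card ht.1]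
  simp

lemma IT_succ (n k : ℕ) (t : Fin (k + 1) → Fin n ⊕ Fin n → ZMod 2) :
    IT n (k + 1) t ↔ IT n k (Fin.tail t) ∧ t 0 ∈ ExtS n k (Fin.tail t) := by
  have h : t 0 ∈ LinearMap.ker (pair n k (Fin.tail t)) ↔ ∀ i : Fin k, om n (t i.succ) (t 0) = 0 := by
    rw [LinearMap.mem_ker, funext_iff]
    simp only [pair_apply]; rfl
  rw [IT, IT, linearIndependent_finSucc, ExtS, Set.mem_sdiff, SetLike.mem_coe, SetLike.mem_coe, h]
  simp only [Fin.forall_fin_succ, om_self, Fin.tail, om_comm n (t 0)]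
  grind

lemma card_IT (n k : ℕ) : Nat.card {t // IT n k t} =
    ∏ i ∈ Finset.range k, (2 ^ (2 * n - i) - 2 ^ i) := by
  classical
  induction k with
  | zero =>
    have : Unique {t // IT n 0 t} := 
      { default := ⟨Fin.elim0, linearIndependent_empty_type, fun i => i.elim0⟩
        uniq := fun a => Subtype.ext (Subsingleton.elim _ _) }
    simp
  | succ k ih =>
    let e : {t // IT n (k + 1) t} ≃ Σ t : {t // IT n k t}, ExtS n k t.1 :=
      { toFun := fun t => ⟨⟨Fin.tail t.1, ((IT_succ n k _).1 t.2).1⟩, t.1 0, ((IT_succ n k _).1 t.2).2⟩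
        invFun := fun x => ⟨Fin.cons x.2.1 x.1.1, (IT_succ n k _).2 (by
          exact ⟨x.1.2, x.2.2⟩)⟩
        left_inv := fun t => Subtype.ext (Fin.cons_self_tail _)
        right_inv := fun x => by rfl }
    have : Fintype {t // IT n k t} := Fintype.ofFinite _
    rw [Nat.card_congr e, Nat.card_sigma, Finset.prod_range_succ, ← ih,
      Finset.sum_congr rfl (fun t _ => card_ExtS n k t.1 t.2)]
    simp [Nat.card_eq_fintype_card]

/-- Symplectic matrices -/
abbrev SpM (n : ℕ) := {M : Matrix (Fin n ⊕ Fin n) (Fin n ⊕ Fin n) (ZMod 2) //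
        Mᵀ * Omega n * M = Omega n}

lemma mul_Om_apply (n : ℕ) {k l : Type*} (A : Matrix k (Fin n ⊕ Fin n) (ZMod 2))
    (B : Matrix l (Fin n ⊕ Fin n) (ZMod 2)) (i j) :
    (A * Omega n * Bᵀ) i j = om n (A i) (B j) := by
  rw [Matrix.mul_assoc, Matrix.mul_apply_eq_vecMul, om, ← Matrix.mulVec_transpose]
  simp [Matrix.mulVec, dotProduct, Matrix.mul_apply, mul_comm]

lemma exists_full (n : ℕ) (e : Fin n → Fin n ⊕ Fin n → ZMod 2) (he : IT n n e) :
    ∃ M : SpM n, ∀ i, M.1.col (Sum.inr i) = e i := by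
  have hsur : ∀ j : Fin n, ∃ g, pair n n e g = Pi.single j 1 := fun j =>
    LinearMap.range_eq_top.1 (pair_range n n e he.1) _
  choose g hg using hsur
  have hg' : ∀ i j, om n (e i) (g j) = if i = j then 1 else 0 := fun i j => by
    rw [← pair_apply, hg, Pi.single_apply]
  let E : Matrix (Fin n) (Fin n ⊕ Fin n) (ZMod 2) := Matrix.of e
  let G : Matrix (Fin n) (Fin n ⊕ Fin n) (ZMod 2) := Matrix.of g
  let U : Matrix (Fin n) (Fin n) (ZMod 2) := Matrix.of fun i j => if i < j then om n (g i) (g j) else 0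
  have hEE : E * Omega n * Eᵀ = 0 := by
    ext i j; rw [mul_Om_apply]; exact he.2 i j
  have hEG : E * Omega n * Gᵀ = 1 := by
    ext i j; rw [mul_Om_apply, Matrix.one_apply]; exact hg' i j
  have hGE : G * Omega n * Eᵀ = 1 := by
    ext i j; rw [mul_Om_apply, Matrix.one_apply, om_comm]; simp only [eq_comm (a := i)]; exact hg' j i
  have hGG : G * Omega n * Gᵀ = U + Uᵀ := by
    ext i j
    rw [mul_Om_apply]
    change om n (g i) (g j) = (if i < j then om n (g i) (g j) else 0) +
      (if j < i then om n (g j) (g i) else 0)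
    rcases lt_trichotomy i j with h | h | h
    · simp [h, h.le.not_gt]
    · subst h; simp [om_self]
    · simp [h, h.le.not_gt, om_comm]
  let F := G + U * E
  have hFE : F * Omega n * Eᵀ = 1 := by
    simp only [F, Matrix.add_mul, hGE, Matrix.mul_assoc U, hEE]; simp
  have hEF : E * Omega n * Fᵀ = 1 := by
    simp only [F, Matrix.transpose_add, Matrix.transpose_mul, Matrix.mul_add, hEG,
      ← Matrix.mul_assoc, hEE]; simp
  have hFF : F * Omega n * Fᵀ = 0 := by
    have h : F * Omega n * Fᵀ = F * Omega n * Gᵀ + F * Omega n * Eᵀ * Uᵀ := by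
      conv_lhs => rw [show Fᵀ = Gᵀ + Eᵀ * Uᵀ by simp [F]]
      rw [Matrix.mul_add, ← Matrix.mul_assoc]
    have h2 : F * Omega n * Gᵀ = U + Uᵀ + U := by
      simp only [F, Matrix.add_mul, hGG, Matrix.mul_assoc U, hEG]; simp
    rw [h, h2, hFE]
    ext i j
    simp only [Matrix.add_apply, Matrix.one_mul, Matrix.zero_apply]
    have := CharTwo.add_self_eq_zero (U i j)
    have := CharTwo.add_self_eq_zero (Uᵀ i j)
    grind
  refine ⟨⟨(Matrix.fromRows F E)ᵀ, ?_⟩, fun i => rfl⟩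
  rw [Matrix.transpose_transpose, Matrix.transpose_fromRows, Matrix.fromRows_mul,
    Matrix.fromRows_mul_fromCols, hFF, hFE, hEF, hEE, Omega]

lemma exists_ext (m : ℕ) (t : Fin m → Fin (m+1) ⊕ Fin (m+1) → ZMod 2) (ht : IT (m+1) m t) :
    ∃ M : SpM (m+1), ∀ i : Fin m, M.1.col (Sum.inr i.succ) = t i := by
  have hpos : 0 < Nat.card (ExtS (m+1) m t) := by
    rw [card_ExtS _ _ _ ht]
    exact Nat.sub_pos_of_lt (Nat.pow_lt_pow_right (by norm_num) (by omega))
  obtain ⟨⟨w, hw⟩⟩ := (Nat.card_pos_iff.1 hpos).1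
  obtain ⟨M, hM⟩ := exists_full (m+1) (Fin.cons w t) ((IT_succ _ _ _).2 (by exact ⟨ht, hw⟩))
  exact ⟨M, fun i => by rw [hM]; simp⟩


lemma SpM_isUnit {n : ℕ} (M : SpM n) : IsUnit M.1 := by
  have h : (Omega n * M.1ᵀ * Omega n) * M.1 = 1 := by
    rw [Matrix.mul_assoc, Matrix.mul_assoc, ← Matrix.mul_assoc (M.1ᵀ), M.2, Omega_sq]
  exact IsUnit.of_mul_eq_one_right _ h

lemma SpM_mul {n : ℕ} (A B : SpM n) : (A.1 * B.1)ᵀ * Omega n * (A.1 * B.1) = Omega n := by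
  calc _ = B.1ᵀ * (A.1ᵀ * Omega n * A.1) * B.1 := by
        rw [Matrix.transpose_mul]; simp only [Matrix.mul_assoc]
    _ = _ := by rw [A.2, B.2]

lemma SpM_inv {n : ℕ} (A : SpM n) : ∃ B : SpM n, A.1 * B.1 = 1 ∧ B.1 * A.1 = 1 := by
  obtain ⟨u, hu⟩ := SpM_isUnit A
  have h1 : A.1 * (↑u⁻¹ : Matrix (Fin n ⊕ Fin n) (Fin n ⊕ Fin n) (ZMod 2)) = 1 := by rw [← hu]; exact u.mul_inv
  have h2 : (↑u⁻¹ : Matrix (Fin n ⊕ Fin n) (Fin n ⊕ Fin n) (ZMod 2)) * A.1 = 1 := by rw [← hu]; exact u.inv_mul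
  generalize (↑u⁻¹ : Matrix (Fin n ⊕ Fin n) (Fin n ⊕ Fin n) (ZMod 2)) = B at h1 h2
  refine ⟨⟨B, ?_⟩, h1, h2⟩
  calc Bᵀ * Omega n * B = Bᵀ * (A.1ᵀ * Omega n * A.1) * B := by rw [A.2]
    _ = (A.1 * B)ᵀ * Omega n * (A.1 * B) := by
        rw [Matrix.transpose_mul]; simp only [Matrix.mul_assoc]
    _ = _ := by rw [h1]; simp

/-- The columns of a symplectic matrix at the base positions. -/
def cmap (m : ℕ) (M : SpM (m+1)) : {t // IT (m+1) m t} :=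
  ⟨fun i => M.1.col (Sum.inr i.succ), by
    constructor
    · have := Matrix.linearIndependent_cols_of_isUnit (SpM_isUnit M)
      exact this.comp (fun i : Fin m => Sum.inr i.succ)
        (Sum.inr_injective.comp (Fin.succ_injective m))
    · intro i j
      have h := mul_Om_apply (m+1) M.1ᵀ M.1ᵀ (Sum.inr i.succ) (Sum.inr j.succ)
      rw [Matrix.transpose_transpose, M.2] at h
      exact h.symm⟩

lemma col_mul' {n : ℕ} (A B : Matrix (Fin n ⊕ Fin n) (Fin n ⊕ Fin n) (ZMod 2)) (j) :
    (A * B).col j = A *ᵥ B.col j := by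
  ext i; simp [Matrix.mul_apply, Matrix.mulVec, dotProduct]

lemma fib_const (m : ℕ) (t : {t // IT (m+1) m t}) :
    Nat.card {M // cmap m M = t} =
      Nat.card {M // cmap m M = cmap m ⟨1, by simp⟩} := by
  obtain ⟨A, hA⟩ := exists_ext m t.1 t.2
  have hA' : cmap m A = t := Subtype.ext (funext hA)
  obtain ⟨B, hAB, hBA⟩ := SpM_inv A
  have key : ∀ (C M N : SpM (m+1)), cmap m M = cmap m N →
      cmap m ⟨C.1 * M.1, SpM_mul C M⟩ = cmap m ⟨C.1 * N.1, SpM_mul C N⟩ := by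
    intro C M N h
    apply Subtype.ext
    funext i
    have := congrFun (congrArg Subtype.val h) i
    simp only [cmap] at this ⊢
    rw [col_mul', col_mul', this]
  refine Nat.card_congr
    { toFun := fun M => ⟨⟨B.1 * M.1.1, SpM_mul B M.1⟩, ?_⟩
      invFun := fun M => ⟨⟨A.1 * M.1.1, SpM_mul A M.1⟩, ?_⟩
      left_inv := fun M => ?_
      right_inv := fun M => ?_ }
  · rw [key B M.1 A (M.2.trans hA'.symm)]
    congr 1
    exact Subtype.ext hBA
  · rw [key A M.1 _ M.2, ← hA']
    congr 1
    exact Subtype.ext (Matrix.mul_one _)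
  · apply Subtype.ext; apply Subtype.ext
    change A.1 * (B.1 * M.1.1) = M.1.1
    rw [← Matrix.mul_assoc, hAB, Matrix.one_mul]
  · apply Subtype.ext; apply Subtype.ext
    change B.1 * (A.1 * M.1.1) = M.1.1
    rw [← Matrix.mul_assoc, hBA, Matrix.one_mul]

lemma fib_card {α β : Type*} [Finite α] [Finite β] (c : α → β) (P : β → Prop) (f : ℕ)
    (h : ∀ b, Nat.card {a // c a = b} = f) :
    Nat.card {a // P (c a)} = Nat.card {b // P b} * f := by
  classical
  have : Fintype {b // P b} := Fintype.ofFinite _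
  rw [← Nat.card_congr (Equiv.sigmaSubtypeFiberEquivSubtype c (p := fun a => P (c a)) (q := P)
    (fun _ => Iff.rfl)), Nat.card_sigma, Finset.sum_congr rfl (fun b _ => h b.1)]
  · rw [Finset.sum_const, Finset.card_univ, Nat.card_eq_fintype_card, smul_eq_mul]

def baseW (m : ℕ) : Submodule (ZMod 2) (Fin (m+1) ⊕ Fin (m+1) → ZMod 2) where
  carrier := base (m+1) (Nat.succ_pos m)
  add_mem' := by
    rintro a b ⟨h1, h2⟩ ⟨h3, h4⟩
    exact ⟨fun i => by simp [h1, h3], by rw [Pi.add_apply, h2, h4, add_zero]⟩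
  zero_mem' := ⟨fun i => rfl, rfl⟩
  smul_mem' := by
    rintro c a ⟨h1, h2⟩
    exact ⟨fun i => by simp [h1], by rw [Pi.smul_apply, h2, smul_zero]⟩

def baseEquiv (m : ℕ) : baseW m ≃ₗ[ZMod 2] (Fin m → ZMod 2) where
  toFun v i := v.1 (Sum.inr i.succ)
  map_add' _ _ := rfl
  map_smul' _ _ := rfl
  invFun w := ⟨Sum.elim 0 (Fin.cons 0 w), fun i => rfl, rfl⟩
  left_inv := by
    rintro ⟨v, h1, h2⟩
    apply Subtype.ext
    funext j
    rcases j with j | j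
    · exact (h1 j).symm
    · refine Fin.cases ?_ (fun i => ?_) j
      · exact h2.symm
      · rfl
  right_inv w := rfl

lemma finrank_baseW (m : ℕ) : Module.finrank (ZMod 2) (baseW m) = m := by
  rw [(baseEquiv m).finrank_eq, Module.finrank_fin_fun]

lemma card_TB (m : ℕ) :
    Nat.card {t : {t // IT (m+1) m t} // ∀ i, t.1 i ∈ baseW m} =
      ∏ i ∈ Finset.range m, (2 ^ m - 2 ^ i) := by
  have h := card_linearIndependent (K := ZMod 2) (V := baseW m) (k := m) (finrank_baseW m).ge
  rw [finrank_baseW, ZMod.card, Fin.prod_univ_eq_prod_range (fun i => 2 ^ m - 2 ^ i)] at h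
  rw [← h]
  refine Nat.card_congr
    { toFun := fun t => ⟨fun i => ⟨t.1.1 i, t.2 i⟩, ?_⟩
      invFun := fun s => ⟨⟨fun i => (s.1 i).1, ?_, ?_⟩, fun i => (s.1 i).2⟩
      left_inv := fun t => rfl
      right_inv := fun s => rfl }
  · exact LinearIndependent.of_comp (baseW m).subtype t.1.2.1
  · exact s.2.map' (baseW m).subtype (Submodule.ker_subtype _)
  · intro i j
    rw [om_eq]
    refine Finset.sum_eq_zero fun k _ => ?_
    beta_reduce
    rw [(s.1 i).2.1 k, (s.1 j).2.1 k]
    simp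

lemma stab_iff (m : ℕ) (M : SpM (m+1)) :
    M.1.mulVec '' base (m+1) (Nat.succ_pos m) = base (m+1) (Nat.succ_pos m) ↔
      ∀ i, (cmap m M).1 i ∈ baseW m := by
  constructor
  · intro h i
    change M.1.col (Sum.inr i.succ) ∈ base (m+1) (Nat.succ_pos m)
    rw [← h]
    refine ⟨Pi.single (Sum.inr i.succ) 1, ⟨fun j => ?_, ?_⟩, ?_⟩
    · simp
    · rw [Pi.single_apply, if_neg]
      intro h
      exact Fin.succ_ne_zero i (Sum.inr_injective h).symm
    · simp
  · intro h
    have hinj : Function.Injective M.1.mulVec :=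
      Matrix.mulVec_injective_of_isUnit (SpM_isUnit M)
    refine Set.eq_of_subset_of_ncard_le ?_ (Set.ncard_image_of_injective _ hinj).ge (Set.toFinite _)
    rintro _ ⟨v, ⟨h1, h2⟩, rfl⟩
    change M.1 *ᵥ v ∈ baseW m
    have hv : M.1 *ᵥ v = ∑ j, v j • M.1.col j := by
      ext i
      simp [Matrix.mulVec, dotProduct, mul_comm]
    rw [hv]
    refine Submodule.sum_mem _ fun j hj => ?_
    clear hj
    rcases j with j | j
    · rw [h1 j, zero_smul]; exact Submodule.zero_mem _
    · revert j
      refine Fin.cases ?_ (fun i => ?_)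
      · have : v (Sum.inr 0) = 0 := h2
        rw [this, zero_smul]; exact Submodule.zero_mem _
      · exact Submodule.smul_mem _ _ (h i)

lemma arith (m : ℕ) :
    3 * ∏ i ∈ Finset.range m, (2 ^ (2 * (m + 1) - i) - 2 ^ i) =
      (∏ i ∈ Finset.range m, (2 ^ m - 2 ^ i)) *
        ((2 ^ (m + 1) - 1) * ∏ j ∈ Finset.Icc 1 (m + 1), (2 ^ j + 1)) := by
  have e1 : ∏ i ∈ Finset.range m, (2 ^ (2 * (m + 1) - i) - 2 ^ i) =
      (∏ i ∈ Finset.range m, 2 ^ i) * (∏ i ∈ Finset.range m, (2 ^ (m + 1 - i) - 1)) *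
        ∏ i ∈ Finset.range m, (2 ^ (m + 1 - i) + 1) := by
    rw [← Finset.prod_mul_distrib, ← Finset.prod_mul_distrib]
    refine Finset.prod_congr rfl fun i hi => ?_
    have hi := Finset.mem_range.1 hi
    have h2 : 2 * (m + 1) - i = i + (m + 1 - i) + (m + 1 - i) := by omega
    rw [h2, pow_add, pow_add]
    have h3 : 1 ≤ 2 ^ (m + 1 - i) := Nat.one_le_two_pow
    have h4 : 2 ^ i ≤ 2 ^ i * 2 ^ (m + 1 - i) * 2 ^ (m + 1 - i) := by
      rw [mul_assoc]; exact Nat.le_mul_of_pos_right _ (by positivity)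
    zify [h3, h4]
    ring
  have e2 : ∏ i ∈ Finset.range m, (2 ^ m - 2 ^ i) =
      (∏ i ∈ Finset.range m, 2 ^ i) * (∏ i ∈ Finset.range m, (2 ^ (m - i) - 1)) := by
    rw [← Finset.prod_mul_distrib]
    refine Finset.prod_congr rfl fun i hi => ?_
    have hi := Finset.mem_range.1 hi
    rw [Nat.mul_sub, ← pow_add, mul_one, Nat.add_sub_cancel' hi.le]
  have e3 : ∏ i ∈ Finset.range m, (2 ^ (m + 1 - i) - 1) =
      (∏ i ∈ Finset.range m, (2 ^ (m - i) - 1)) * (2 ^ (m + 1) - 1) := by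
    have a := Finset.prod_range_succ (fun i => 2 ^ (m + 1 - i) - 1) m
    have b := Finset.prod_range_succ' (fun i => 2 ^ (m + 1 - i) - 1) m
    rw [a] at b
    simpa using b
  have e4 : ∏ j ∈ Finset.Icc 1 (m + 1), (2 ^ j + 1) =
      3 * ∏ i ∈ Finset.range m, (2 ^ (m + 1 - i) + 1) := by
    have a := Finset.prod_range_succ (fun i => 2 ^ (m + 1 - i) + 1) m
    have b := Finset.prod_range_reflect (fun i => 2 ^ (i + 1) + 1) (m + 1)
    have c : ∏ j ∈ Finset.Icc 1 (m + 1), (2 ^ j + 1) =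
        ∏ j ∈ Finset.range (m + 1), (2 ^ (j + 1) + 1) := by
      rw [← Finset.Ico_add_one_right_eq_Icc, Finset.prod_Ico_eq_prod_range]
      simp [add_comm]
    rw [c, ← b, mul_comm]
    have d : ∏ j ∈ Finset.range (m + 1), (2 ^ (m + 1 - 1 - j + 1) + 1) =
        ∏ j ∈ Finset.range (m + 1), (2 ^ (m + 1 - j) + 1) := by
      refine Finset.prod_congr rfl fun i hi => ?_
      have hi := Finset.mem_range.1 hi
      rw [show m + 1 - 1 - i + 1 = m + 1 - i by omega]
    rw [d, a]
    simp
  rw [e1, e2, e3, e4]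
  ring


/-- The index `[Sp(2n,F₂) : Dₙ]` equals `(1/3)(2ⁿ − 1)∏_{j=1}^{n}(2ʲ + 1)`, stated
multiplicatively: `3 ⬝ |Sp(2n,F₂)| = |Dₙ| ⬝ (2ⁿ − 1)∏_{j=1}^{n}(2ʲ + 1)`. -/
theorem index_distillation_subgroup (n : ℕ) (hn : 1 < n) :
    3 * Nat.card {M : Matrix (Fin n ⊕ Fin n) (Fin n ⊕ Fin n) (ZMod 2) //
        Mᵀ * Omega n * M = Omega n} =
      Nat.card {M : Matrix (Fin n ⊕ Fin n) (Fin n ⊕ Fin n) (ZMod 2) //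
          Mᵀ * Omega n * M = Omega n ∧
            M.mulVec '' base n (by omega) = base n (by omega)} *
        ((2 ^ n - 1) * ∏ j ∈ Finset.Icc 1 n, (2 ^ j + 1)) := by

  obtain ⟨m, rfl⟩ : ∃ m, n = m + 1 := ⟨n - 1, by omega⟩
  have h1 := fib_card (cmap m) (fun _ => True) _ (fib_const m)
  have h2 := fib_card (cmap m) (fun t => ∀ i, t.1 i ∈ baseW m) _ (fib_const m)
  rw [card_TB] at h2
  rw [Nat.card_congr (Equiv.subtypeUnivEquiv (fun _ => trivial)),
    Nat.card_congr (Equiv.subtypeUnivEquiv (fun _ => trivial)), card_IT] at h1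
  have h3 : Nat.card {M : Matrix (Fin (m+1) ⊕ Fin (m+1)) (Fin (m+1) ⊕ Fin (m+1)) (ZMod 2) //
          Mᵀ * Omega (m+1) * M = Omega (m+1) ∧
            M.mulVec '' base (m+1) (by omega) = base (m+1) (by omega)} =
      Nat.card {M : SpM (m+1) // ∀ i, (cmap m M).1 i ∈ baseW m} := by
    refine Nat.card_congr ((Equiv.subtypeSubtypeEquivSubtypeInter _ _).symm.trans
      (Equiv.subtypeEquivRight fun M => stab_iff m M))
  rw [h3, h2, h1, ← mul_assoc, arith]
  ring
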